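/- Lemma 3.5, part 1 (bound on the gradient term). There exist universal constants c, C > 0 such that the following holds. Let δ > 0, σ⁺ > 0, μ ≥ 1 and r ≤ q. Let U be an n×r real matrix, and for k ∈ [q] let b̂_k ∈ ℝ^r, x̂_k := Ub̂_k, and x*_k ∈ ℝⁿ; let B̂ be the r×q matrix with columns b̂_k and X̂, X* the n×q matrices with columns x̂_k, x*_k. Assume (all deterministic): max_k ‖b̂_k‖ ≤ 1.1·μσ⁺√(r/q); max_k ‖x̂_k − x*_k‖ ≤ 1.4·δ·μσ⁺√(r/q); ‖X̂ − X*‖_F ≤ 1.1·δ·σ⁺; and ‖B̂‖ ≤ 1.1·σ⁺. Let a_ki (k ∈ [q], i ∈ [m]) be i.i.d. standard Gaussian random vectors in ℝⁿ. Then for every ε₁ ∈ (0,1), with probability at least 1 − exp(C(n+r) − c·mq·ε₁²/(r·μ²)), ‖Σ_{k,i} a_ki·a_kiᵀ·(x̂_k − x*_k)·b̂_kᵀ‖ ≤ 1.5·(1.1 + ε₁)·m·δ·σ⁺². -/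

import Mathlib

open MeasureTheory ProbabilityTheory Matrix
open scoped ENNReal

noncomputable section

/-- Euclidean norm of a finitely-indexed real vector. -/
def vnorm {ι : Type*} [Fintype ι] (v : ι → ℝ) : ℝ := Real.sqrt (∑ i, v i ^ 2)

/-- Frobenius norm of a real matrix. -/
def frob {ι ι' : Type*} [Fintype ι] [Fintype ι'] (M : Matrix ι ι' ℝ) : ℝ :=
  Real.sqrt (∑ i, ∑ j, M i j ^ 2)

/-- Spectral (ℓ2 operator) norm of a real matrix. -/
def spec {ι ι' : Type*} [Fintype ι] [Fintype ι'] (M : Matrix ι ι' ℝ) : ℝ :=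
  sSup {c | ∃ z, vnorm z = 1 ∧ c = vnorm (M.mulVec z)}

/-- Smallest singular value of an r×q matrix with r ≤ q (or of a square matrix):
the minimum of ‖Bᵀw‖ over unit vectors w. -/
def sigMin {ι ι' : Type*} [Fintype ι] [Fintype ι'] (B : Matrix ι ι' ℝ) : ℝ :=
  sInf {c | ∃ w, vnorm w = 1 ∧ c = vnorm (Bᵀ.mulVec w)}

/-- The k-th column of a matrix. -/
def matCol {ι ι' : Type*} (B : Matrix ι ι' ℝ) (k : ι') : ι → ℝ := fun i => B i k

/-- Subspace distance SD(U₁,U₂) := ‖(I − U₁U₁ᵀ)U₂‖_F. -/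
def SD {n r : ℕ} (U₁ U₂ : Matrix (Fin n) (Fin r) ℝ) : ℝ :=
  frob ((1 - U₁ * U₁ᵀ) * U₂)

/-- The standard Gaussian measure on ℝ. -/
def stdGaussian : Measure ℝ := gaussianReal 0 1

instance : IsProbabilityMeasure stdGaussian :=
  inferInstanceAs (IsProbabilityMeasure (gaussianReal 0 1))

/-- A standard Gaussian random vector in ℝⁿ (i.i.d. N(0,1) coordinates). -/
def gaussianVec (n : ℕ) : Measure (Fin n → ℝ) := Measure.pi fun _ => stdGaussian

instance (n : ℕ) : IsProbabilityMeasure (gaussianVec n) := by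
  unfold gaussianVec; infer_instance

/-- i.i.d. standard Gaussian random vectors a_{k i} ∈ ℝⁿ, k ∈ [q], i ∈ [m]. -/
def gaussianMatrices (q m n : ℕ) : Measure (Fin q → Fin m → Fin n → ℝ) :=
  Measure.pi fun _ => Measure.pi fun _ => gaussianVec n

instance (q m n : ℕ) : IsProbabilityMeasure (gaussianMatrices q m n) := by
  unfold gaussianMatrices; infer_instance

/-- Truncated spectral-initialization matrix X̂₀ = (1/m) Σ_{k,i} a_ki y_ki 1{y_ki² ≤ α} e_kᵀ. -/
def initMat {n q m : ℕ} (xstar : Fin q → Fin n → ℝ) (α : ℝ)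
    (ω : Fin q → Fin m → Fin n → ℝ) : Matrix (Fin n) (Fin q) ℝ :=
  Matrix.of fun j k => (1 / (m : ℝ)) * ∑ i, ω k i j * (ω k i ⬝ᵥ xstar k) *
    (if (ω k i ⬝ᵥ xstar k) ^ 2 ≤ α then 1 else 0)

/-- Data-dependent truncation threshold α := C̃ Σ_{k,i} y_ki² / (mq). -/
def initAlpha {n q m : ℕ} (xstar : Fin q → Fin n → ℝ) (Ctil : ℝ)
    (ω : Fin q → Fin m → Fin n → ℝ) : ℝ :=
  Ctil * ((∑ k, ∑ i, (ω k i ⬝ᵥ xstar k) ^ 2) / ((m : ℝ) * q))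

/-- β(α) := E[ζ² 1{‖x‖² ζ² ≤ α}] for ζ standard Gaussian. -/
def betaK (normx α : ℝ) : ℝ :=
  ∫ z, z ^ 2 * (if normx ^ 2 * z ^ 2 ≤ α then 1 else 0) ∂stdGaussian

/-- The least-squares estimate b̂ := (UᵀAᵀAU)⁻¹ Uᵀ Aᵀ A x. -/
def lsEst {n r m : ℕ} (U : Matrix (Fin n) (Fin r) ℝ) (A : Matrix (Fin m) (Fin n) ℝ)
    (x : Fin n → ℝ) : Fin r → ℝ :=
  ((Uᵀ * Aᵀ * A * U)⁻¹ * Uᵀ * Aᵀ * A).mulVec x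

/-- Gradient w.r.t. U of the squared loss: Σ_k Aᵀ(AUb̂_k − Ax*_k)b̂_kᵀ. -/
def gradU {n r q m : ℕ} (U : Matrix (Fin n) (Fin r) ℝ)
    (A : Fin q → Matrix (Fin m) (Fin n) ℝ) (xstar : Fin q → Fin n → ℝ)
    (bhat : Fin q → Fin r → ℝ) : Matrix (Fin n) (Fin r) ℝ :=
  ∑ k, (A k)ᵀ * vecMulVec ((A k).mulVec (U.mulVec (bhat k) - xstar k)) (bhat k)

/-- `U` has orthonormal columns whose span is the span of eigenvectors of `S`
corresponding to its `r` largest eigenvalues: `S` maps the column span of `U` into itself,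
and wᵀSw ≥ zᵀSz for unit w in the span and unit z orthogonal to it. -/
def IsTopREigenBasis {n r : ℕ} (S : Matrix (Fin n) (Fin n) ℝ)
    (U : Matrix (Fin n) (Fin r) ℝ) : Prop :=
  Uᵀ * U = 1 ∧ (∃ M : Matrix (Fin r) (Fin r) ℝ, S * U = U * M) ∧
  ∀ w z : Fin n → ℝ, (∃ cvec : Fin r → ℝ, w = U.mulVec cvec) → Uᵀ.mulVec z = 0 →
    vnorm w = 1 → vnorm z = 1 → z ⬝ᵥ S.mulVec z ≤ w ⬝ᵥ S.mulVec w

/-- Sample sizes for the 2T+1 sample splits: batch τ ∈ {0,…,T} has m τ rows,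
batch τ = T + t (t ∈ {1,…,T}) has m t rows. -/
def msize (m : ℕ → ℕ) (T τ : ℕ) : ℕ := if τ ≤ T then m τ else m (τ - T)

/-- The joint distribution of all 2T+1 independent sample batches of i.i.d. standard
Gaussian measurement vectors. -/
def splitGauss (m : ℕ → ℕ) (T q n : ℕ) :
    Measure (∀ τ : Fin (2 * T + 1), Fin q → Fin (msize m T τ.1) → Fin n → ℝ) :=
  Measure.pi fun τ => gaussianMatrices q (msize m T τ.1) n

instance (m : ℕ → ℕ) (T q n : ℕ) : IsProbabilityMeasure (splitGauss m T q n) := by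
  unfold splitGauss; infer_instance

end

section Vnorm

variable {ι ι' : Type*} [Fintype ι] [Fintype ι']

lemma vnorm_nonneg (v : ι → ℝ) : 0 ≤ vnorm v := Real.sqrt_nonneg _

lemma vnorm_sq (v : ι → ℝ) : vnorm v ^ 2 = v ⬝ᵥ v := by
  rw [vnorm, Real.sq_sqrt (Finset.sum_nonneg fun _ _ => sq_nonneg _)]
  simp only [dotProduct, sq]

lemma vnorm_eq_norm (v : ι → ℝ) : vnorm v = ‖WithLp.toLp 2 v‖ := by
  simp [vnorm, EuclideanSpace.norm_eq]

lemma vnorm_smul (c : ℝ) (v : ι → ℝ) : vnorm (c • v) = |c| * vnorm v := by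
  rw [vnorm_eq_norm, vnorm_eq_norm, WithLp.toLp_smul, norm_smul, Real.norm_eq_abs]

lemma abs_dotProduct_le (v w : ι → ℝ) : |v ⬝ᵥ w| ≤ vnorm v * vnorm w := by
  refine abs_le_of_sq_le_sq ?_ (mul_nonneg (vnorm_nonneg _) (vnorm_nonneg _))
  rw [mul_pow, vnorm, vnorm, Real.sq_sqrt (Finset.sum_nonneg fun _ _ => sq_nonneg _),
    Real.sq_sqrt (Finset.sum_nonneg fun _ _ => sq_nonneg _)]
  exact Finset.sum_mul_sq_le_sq_mul_sq _ _ _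

lemma dotProduct_le_vnorm (v w : ι → ℝ) : v ⬝ᵥ w ≤ vnorm v * vnorm w :=
  (le_abs_self _).trans (abs_dotProduct_le v w)

lemma vnorm_mulVec_le_frob (M : Matrix ι ι' ℝ) (z : ι' → ℝ) :
    vnorm (M.mulVec z) ≤ frob M * vnorm z := by
  have h0 : 0 ≤ ∑ i, ∑ j, M i j ^ 2 :=
    Finset.sum_nonneg fun _ _ => Finset.sum_nonneg fun _ _ => sq_nonneg _
  refine (Real.sqrt_le_sqrt ?_).trans_eq (Real.sqrt_mul h0 _)
  rw [Finset.sum_mul]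
  exact Finset.sum_le_sum fun i _ => Finset.sum_mul_sq_le_sq_mul_sq _ (M i) z

lemma spec_nonneg (M : Matrix ι ι' ℝ) : 0 ≤ spec M := by
  refine Real.sSup_nonneg ?_
  rintro _ ⟨z, -, rfl⟩
  exact vnorm_nonneg _

lemma vnorm_mulVec_le_spec (M : Matrix ι ι' ℝ) (z : ι' → ℝ) :
    vnorm (M.mulVec z) ≤ spec M * vnorm z := by
  rcases (vnorm_nonneg z).eq_or_lt with hz | hz
  · have h := vnorm_mulVec_le_frob M z
    rwa [← hz, mul_zero] at h ⊢
  · have hbdd : BddAbove {c | ∃ z, vnorm z = 1 ∧ c = vnorm (M.mulVec z)} := by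
      refine ⟨frob M, ?_⟩
      rintro _ ⟨y, hy, rfl⟩
      simpa [hy] using vnorm_mulVec_le_frob M y
    have hmem : vnorm (M.mulVec ((vnorm z)⁻¹ • z)) ≤ spec M := by
      refine le_csSup hbdd ⟨_, ?_, rfl⟩
      rw [vnorm_smul, abs_of_pos (inv_pos.2 hz), inv_mul_cancel₀ hz.ne']
    rw [mulVec_smul, vnorm_smul, abs_of_pos (inv_pos.2 hz), inv_mul_le_iff₀ hz] at hmem
    linarith

lemma vnorm_vecMul_le_spec (M : Matrix ι ι' ℝ) (z : ι → ℝ) :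
    vnorm (vecMul z M) ≤ spec M * vnorm z := by
  rcases (vnorm_nonneg (vecMul z M)).eq_or_lt with h | h
  · rw [← h]
    exact mul_nonneg (spec_nonneg M) (vnorm_nonneg z)
  · refine le_of_mul_le_mul_right ?_ h
    calc vnorm (vecMul z M) * vnorm (vecMul z M)
        = z ⬝ᵥ M.mulVec (vecMul z M) := by rw [← sq, vnorm_sq, dotProduct_mulVec]
      _ ≤ vnorm z * vnorm (M.mulVec (vecMul z M)) := dotProduct_le_vnorm _ _
      _ ≤ vnorm z * (spec M * vnorm (vecMul z M)) :=
        mul_le_mul_of_nonneg_left (vnorm_mulVec_le_spec _ _) (vnorm_nonneg z)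
      _ = spec M * vnorm z * vnorm (vecMul z M) := by ring

/-- The spectral norm is controlled by the bilinear form on `1/8`-nets of the unit balls. -/
lemma spec_le_of_net (M : Matrix ι ι' ℝ) {N : Finset (ι → ℝ)} {N' : Finset (ι' → ℝ)} {b : ℝ}
    (hb : 0 ≤ b) (hN : ∀ w ∈ N, vnorm w ≤ 1)
    (hcov : ∀ w, vnorm w ≤ 1 → ∃ w' ∈ N, vnorm (w - w') ≤ 1 / 8)
    (hcov' : ∀ z, vnorm z ≤ 1 → ∃ z' ∈ N', vnorm (z - z') ≤ 1 / 8)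
    (h : ∀ w ∈ N, ∀ z ∈ N', w ⬝ᵥ M.mulVec z ≤ b) : spec M ≤ 4 / 3 * b := by
  have hS := spec_nonneg M
  suffices H : spec M ≤ b + spec M / 4 by linarith
  refine Real.sSup_le ?_ (by positivity)
  rintro _ ⟨z, hz, rfl⟩
  obtain ⟨w, hw1, hw⟩ : ∃ w, vnorm w ≤ 1 ∧ vnorm (M.mulVec z) = w ⬝ᵥ M.mulVec z := by
    rcases (vnorm_nonneg (M.mulVec z)).eq_or_lt with h0 | h0
    · refine ⟨0, by simp [vnorm], by simp [← h0]⟩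
    · refine ⟨(vnorm (M.mulVec z))⁻¹ • M.mulVec z, ?_, ?_⟩
      · rw [vnorm_smul, abs_of_pos (inv_pos.2 h0), inv_mul_cancel₀ h0.ne']
      · rw [smul_dotProduct, ← vnorm_sq, smul_eq_mul]
        field_simp
  obtain ⟨w', hw'N, hw'⟩ := hcov w hw1
  obtain ⟨z', hz'N, hz'⟩ := hcov' z hz.le
  have e : w ⬝ᵥ M.mulVec z =
      w' ⬝ᵥ M.mulVec z' + (w - w') ⬝ᵥ M.mulVec z + w' ⬝ᵥ M.mulVec (z - z') := by
    simp only [sub_dotProduct, mulVec_sub, dotProduct_sub]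
    ring
  have h1 : (w - w') ⬝ᵥ M.mulVec z ≤ 1 / 8 * spec M := by
    refine (dotProduct_le_vnorm _ _).trans (mul_le_mul hw' ?_ (vnorm_nonneg _) (by norm_num))
    simpa [hz] using vnorm_mulVec_le_spec M z
  have h2 : w' ⬝ᵥ M.mulVec (z - z') ≤ 1 * (spec M * (1 / 8)) := by
    refine (dotProduct_le_vnorm _ _).trans
      (mul_le_mul (hN _ hw'N) ?_ (vnorm_nonneg _) (by norm_num))
    exact (vnorm_mulVec_le_spec M _).trans (mul_le_mul_of_nonneg_left hz' hS)
  have h3 := h w' hw'N z' hz'N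
  rw [hw, e]
  linarith

end Vnorm

section Net

open Metric Module

/-- A `1/8`-separated subset of the unit ball has at most `17 ^ dim` elements. -/
lemma card_le_of_separated_unitBall {E : Type*} [NormedAddCommGroup E] [NormedSpace ℝ E]
    [FiniteDimensional ℝ E] (s : Finset E) (hs : ∀ c ∈ s, ‖c‖ ≤ 1)
    (h : ∀ c ∈ s, ∀ d ∈ s, c ≠ d → 1 / 8 ≤ ‖c - d‖) : s.card ≤ 17 ^ finrank ℝ E := by
  borelize E
  let ν : Measure E := Measure.addHaar
  have hdisj : Set.PairwiseDisjoint (s : Set E) fun c => ball c (1 / 16 : ℝ) := by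
    intro c hc d hd hcd
    refine ball_disjoint_ball ?_
    rw [dist_eq_norm]
    linarith [h c hc d hd hcd]
  have hsub : (⋃ c ∈ s, ball c (1 / 16 : ℝ)) ⊆ ball (0 : E) (17 / 16) := by
    refine Set.iUnion₂_subset fun x hx => ball_subset_ball' ?_
    rw [dist_zero_right]
    linarith [hs x hx]
  have hvol : (s.card : ℝ≥0∞) * ENNReal.ofReal ((1 / 16) ^ finrank ℝ E) * ν (ball 0 1) ≤
      ENNReal.ofReal ((17 / 16) ^ finrank ℝ E) * ν (ball 0 1) := by
    have := measure_mono (μ := ν) hsub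
    rw [measure_biUnion_finset hdisj fun c _ => measurableSet_ball,
      ν.addHaar_ball_of_pos _ (by norm_num)] at this
    simpa only [ν.addHaar_ball_of_pos _ (show (0 : ℝ) < 1 / 16 by norm_num), Finset.sum_const,
      nsmul_eq_mul, mul_assoc] using this
  have hcard := (ENNReal.mul_le_mul_iff_left (measure_ball_pos ν _ zero_lt_one).ne'
    measure_ball_lt_top.ne).1 hvol
  have hreal : (s.card : ℝ) ≤ (17 : ℝ) ^ finrank ℝ E := by
    have := ENNReal.toReal_le_of_le_ofReal (by positivity) hcard
    simpa [div_eq_mul_inv, mul_pow] using this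
  exact mod_cast hreal

lemma exists_net_unitBall (n : ℕ) : ∃ N : Finset (Fin n → ℝ), N.card ≤ 17 ^ n ∧
    (∀ w ∈ N, vnorm w ≤ 1) ∧ ∀ w, vnorm w ≤ 1 → ∃ w' ∈ N, vnorm (w - w') ≤ 1 / 8 := by
  classical
  let E := EuclideanSpace ℝ (Fin n)
  have hε : ((1 / 8 : NNReal) : ℝ≥0∞) = ENNReal.ofReal (1 / 8) := by
    rw [ENNReal.ofReal, Real.toNNReal_div zero_le_one]
    norm_num
  have hfin : ∀ s : Finset E, (s : Set E) ⊆ closedBall 0 1 →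
      IsSeparated ((1 / 8 : NNReal) : ℝ≥0∞) (s : Set E) → s.card ≤ 17 ^ n := by
    intro s hs hsep
    have := card_le_of_separated_unitBall s (fun c hc => by simpa using hs hc)
      fun c hc d hd hcd => by
        have h : ((1 / 8 : NNReal) : ℝ≥0∞) < edist c d := hsep hc hd hcd
        rw [edist_dist, hε, ENNReal.ofReal_lt_ofReal_iff_of_nonneg (by norm_num),
          dist_eq_norm] at h
        exact h.le
    simpa [E] using this
  have hpack : packingNumber (1 / 8) (closedBall (0 : E) 1) ≤ (17 ^ n : ℕ) := by
    refine iSup_le fun C => iSup_le fun hC => iSup_le fun hsep => ?_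
    by_contra! hlt
    obtain ⟨t, htC, ht⟩ := Set.exists_subset_encard_eq (Order.add_one_le_of_lt hlt)
    have htfin : t.Finite := by
      refine Set.encard_ne_top_iff.1 ?_
      rw [ht]
      exact_mod_cast ENat.natCast_ne_top (17 ^ n + 1)
    have := hfin htfin.toFinset (by simpa using htC.trans hC)
      (by simpa using hsep.subset htC)
    rw [htfin.encard_eq_coe_toFinset_card] at ht
    have ht' : htfin.toFinset.card = 17 ^ n + 1 := by exact_mod_cast ht
    omega
  have htop : packingNumber (1 / 8) (closedBall (0 : E) 1) ≠ ⊤ :=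
    ne_top_of_le_ne_top (ENat.natCast_ne_top _) hpack
  have hcard := encard_maximalSeparatedSet htop
  have hsub := maximalSeparatedSet_subset (ε := 1 / 8) (A := closedBall (0 : E) 1)
  have hcov := isCover_maximalSeparatedSet htop
  generalize maximalSeparatedSet (1 / 8) (closedBall (0 : E) 1) = C at hcard hsub hcov
  have hC : C.Finite := Set.encard_ne_top_iff.1 (hcard ▸ htop)
  refine ⟨hC.toFinset.image (WithLp.ofLp), Finset.card_image_le.trans ?_, ?_, ?_⟩
  · rw [← hcard, hC.encard_eq_coe_toFinset_card] at hpack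
    exact_mod_cast hpack
  · intro w hw
    obtain ⟨c, hc, rfl⟩ := Finset.mem_image.1 hw
    have := hsub (hC.mem_toFinset.1 hc)
    simpa [vnorm_eq_norm] using this
  · intro w hw
    obtain ⟨c, hc, hwc⟩ := hcov (x := WithLp.toLp 2 w) (by simpa [vnorm_eq_norm] using hw)
    refine ⟨c.ofLp, Finset.mem_image_of_mem _ (hC.mem_toFinset.2 hc), ?_⟩
    have h : edist (WithLp.toLp 2 w) c ≤ ((1 / 8 : NNReal) : ℝ≥0∞) := hwc
    rw [edist_dist, hε, ENNReal.ofReal_le_ofReal_iff (by norm_num), dist_eq_norm] at h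
    rw [vnorm_eq_norm, WithLp.toLp_sub]
    exact h

end Net

section Gaussian

lemma map_dotProduct_gaussianVec {n : ℕ} (u : Fin n → ℝ) :
    (gaussianVec n).map (fun a => a ⬝ᵥ u) = (gaussianReal 0 1).map (fun x => vnorm u * x) := by
  let L : StrongDual ℝ (EuclideanSpace ℝ (Fin n)) := innerSL ℝ (WithLp.toLp 2 u)
  have hL : (fun a : Fin n → ℝ => a ⬝ᵥ u) = L ∘ WithLp.toLp 2 := by
    ext a
    simp [L, PiLp.inner_apply, dotProduct]
  have hnorm : ‖L‖ = vnorm u := by rw [vnorm_eq_norm]; exact innerSL_apply_norm ℝ _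
  rw [hL, ← Measure.map_map (by fun_prop) (by fun_prop)]
  have : (gaussianVec n).map (WithLp.toLp 2) =
      ProbabilityTheory.stdGaussian (EuclideanSpace ℝ (Fin n)) := map_pi_eq_stdGaussian
  rw [this, IsGaussian.map_eq_gaussianReal, integral_strongDual_stdGaussian,
    variance_dual_stdGaussian, gaussianReal_map_const_mul, hnorm, mul_zero, mul_one]
  congr 1
  exact Real.toNNReal_of_nonneg (sq_nonneg _)

lemma lintegral_exp_sq_gaussianReal {s : ℝ} (hs : |s| ≤ 1 / 4) :
    ∫⁻ x, ENNReal.ofReal (Real.exp (s * x ^ 2)) ∂(gaussianReal 0 1) ≤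
      ENNReal.ofReal (Real.exp (s + 4 * s ^ 2)) := by
  obtain ⟨hs1, hs2⟩ := abs_le.1 hs
  have hb : 0 < 1 / 2 - s := by linarith
  have hpdf : ∀ x : ℝ, gaussianPDF 0 1 x * ENNReal.ofReal (Real.exp (s * x ^ 2)) =
      ENNReal.ofReal ((√(2 * Real.pi))⁻¹ * Real.exp (-(1 / 2 - s) * x ^ 2)) := by
    intro x
    rw [gaussianPDF, ← ENNReal.ofReal_mul (gaussianPDFReal_nonneg _ _ _), gaussianPDFReal,
      mul_assoc, ← Real.exp_add]
    congr 2
    · simp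
    · congr 1
      simp
      ring
  have hlog : Real.log ((√(1 - 2 * s))⁻¹) ≤ s + 4 * s ^ 2 := by
    have h := Real.abs_log_sub_add_sum_range_le (x := 2 * s)
      (by rw [abs_mul, abs_two]; linarith) 1
    simp only [Finset.sum_range_one, zero_add, pow_one, Nat.cast_zero, div_one] at h
    have h2 : |2 * s| ^ (1 + 1) / (1 - |2 * s|) ≤ 8 * s ^ 2 := by
      rw [one_add_one_eq_two, abs_mul, abs_two, div_le_iff₀ (by linarith), ← sq_abs s]
      nlinarith [mul_nonneg (sq_nonneg |s|) (show 0 ≤ 1 / 2 - 2 * |s| by linarith)]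
    rw [Real.log_inv, Real.log_sqrt (by linarith)]
    linarith [(abs_le.1 (h.trans h2)).1]
  rw [gaussianReal_of_var_ne_zero _ one_ne_zero,
    lintegral_withDensity_eq_lintegral_mul _ (measurable_gaussianPDF 0 1) (by fun_prop)]
  simp only [Pi.mul_apply, hpdf]
  rw [← ofReal_integral_eq_lintegral_ofReal ((integrable_exp_neg_mul_sq hb).const_mul _)
    (ae_of_all _ fun x => by positivity), integral_const_mul, integral_gaussian]
  refine ENNReal.ofReal_le_ofReal ?_
  have e : (√(2 * Real.pi))⁻¹ * √(Real.pi / (1 / 2 - s)) = (√(1 - 2 * s))⁻¹ := by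
    rw [← Real.sqrt_inv, ← Real.sqrt_inv, ← Real.sqrt_mul (by positivity)]
    congr 1
    have : (1 - 2 * s) ≠ 0 := by linarith
    have := Real.pi_pos.ne'
    have h3 : (1 / 2 - s) = (1 - 2 * s) / 2 := by ring
    rw [h3]
    field_simp
  rw [e]
  exact (Real.log_le_iff_le_exp (inv_pos.2 (Real.sqrt_pos.2 (by linarith)))).1 hlog

lemma lintegral_exp_sq_gaussianVec {n : ℕ} (u : Fin n → ℝ) {θ : ℝ}
    (hθ : |θ * (u ⬝ᵥ u)| ≤ 1 / 4) :
    ∫⁻ a, ENNReal.ofReal (Real.exp (θ * (a ⬝ᵥ u) ^ 2)) ∂(gaussianVec n) ≤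
      ENNReal.ofReal (Real.exp (θ * (u ⬝ᵥ u) + 4 * (θ * (u ⬝ᵥ u)) ^ 2)) := by
  have hm : Measurable fun a : Fin n → ℝ => a ⬝ᵥ u := by
    simp only [dotProduct]
    fun_prop
  calc ∫⁻ a, ENNReal.ofReal (Real.exp (θ * (a ⬝ᵥ u) ^ 2)) ∂(gaussianVec n)
      = ∫⁻ y, ENNReal.ofReal (Real.exp (θ * y ^ 2)) ∂((gaussianVec n).map fun a => a ⬝ᵥ u) :=
        (lintegral_map (f := fun y => ENNReal.ofReal (Real.exp (θ * y ^ 2)))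
          (by fun_prop) hm).symm
    _ = ∫⁻ x, ENNReal.ofReal (Real.exp (θ * (u ⬝ᵥ u) * x ^ 2)) ∂(gaussianReal 0 1) := by
        rw [map_dotProduct_gaussianVec, lintegral_map (by fun_prop) (by fun_prop)]
        simp only [mul_pow, vnorm_sq, mul_assoc]
    _ ≤ _ := lintegral_exp_sq_gaussianReal hθ

lemma lintegral_exp_mul_le_of_sq {Ω : Type*} [MeasurableSpace Ω] {P : Measure Ω} {f g : Ω → ℝ}
    (hf : Measurable f) {α β : ℝ}
    (h1 : ∫⁻ x, ENNReal.ofReal (Real.exp (2 * f x)) ∂P ≤ ENNReal.ofReal (Real.exp (2 * α)))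
    (h2 : ∫⁻ x, ENNReal.ofReal (Real.exp (2 * g x)) ∂P ≤ ENNReal.ofReal (Real.exp (2 * β))) :
    ∫⁻ x, ENNReal.ofReal (Real.exp (f x + g x)) ∂P ≤ ENNReal.ofReal (Real.exp (α + β)) := by
  have hpt : ∀ x, ENNReal.ofReal (Real.exp (f x + g x)) ≤
      ENNReal.ofReal (Real.exp (β - α) / 2) * ENNReal.ofReal (Real.exp (2 * f x)) +
      ENNReal.ofReal (Real.exp (α - β) / 2) * ENNReal.ofReal (Real.exp (2 * g x)) := by
    intro x
    rw [← ENNReal.ofReal_mul (by positivity), ← ENNReal.ofReal_mul (by positivity),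
      ← ENNReal.ofReal_add (by positivity) (by positivity)]
    refine ENNReal.ofReal_le_ofReal ?_
    have e1 : Real.exp (β - α) / 2 * Real.exp (2 * f x) = Real.exp ((β - α) / 2 + f x) ^ 2 / 2 := by
      rw [div_mul_eq_mul_div, ← Real.exp_add, ← Real.exp_nat_mul]
      congr 2
      push_cast
      ring
    have e2 : Real.exp (α - β) / 2 * Real.exp (2 * g x) = Real.exp ((α - β) / 2 + g x) ^ 2 / 2 := by
      rw [div_mul_eq_mul_div, ← Real.exp_add, ← Real.exp_nat_mul]
      congr 2
      push_cast
      ring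
    have e3 : Real.exp (f x + g x) =
        Real.exp ((β - α) / 2 + f x) * Real.exp ((α - β) / 2 + g x) := by
      rw [← Real.exp_add]
      congr 1
      ring
    rw [e1, e2, e3]
    linarith [two_mul_le_add_sq (Real.exp ((β - α) / 2 + f x)) (Real.exp ((α - β) / 2 + g x))]
  refine (lintegral_mono hpt).trans ?_
  rw [lintegral_add_left (by fun_prop), lintegral_const_mul' _ _ ENNReal.ofReal_ne_top,
    lintegral_const_mul' _ _ ENNReal.ofReal_ne_top]
  refine (add_le_add (mul_le_mul_right h1 _) (mul_le_mul_right h2 _)).trans_eq ?_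
  rw [← ENNReal.ofReal_mul (by positivity), ← ENNReal.ofReal_mul (by positivity),
    ← ENNReal.ofReal_add (by positivity) (by positivity), div_mul_eq_mul_div, div_mul_eq_mul_div,
    ← Real.exp_add, ← Real.exp_add, show β - α + 2 * α = α + β by ring,
    show α - β + 2 * β = α + β by ring, add_halves]

/-- The product of two linear forms of a Gaussian vector is sub-exponential. -/
lemma lintegral_exp_mul_dotProduct_le {n : ℕ} {d w : Fin n → ℝ} (hd : vnorm d ≤ 1)
    (hw : vnorm w ≤ 1) {s : ℝ} (hs : |s| ≤ 1 / 8) :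
    ∫⁻ a, ENNReal.ofReal (Real.exp (s * ((a ⬝ᵥ d) * (a ⬝ᵥ w)))) ∂(gaussianVec n) ≤
      ENNReal.ofReal (Real.exp (s * (d ⬝ᵥ w) + 8 * s ^ 2)) := by
  have hdd : d ⬝ᵥ d ≤ 1 := by
    rw [← vnorm_sq]
    exact pow_le_one₀ (vnorm_nonneg _) hd
  have hww : w ⬝ᵥ w ≤ 1 := by
    rw [← vnorm_sq]
    exact pow_le_one₀ (vnorm_nonneg _) hw
  set v₁ := (d + w) ⬝ᵥ (d + w) with hv₁
  set v₂ := (d - w) ⬝ᵥ (d - w) with hv₂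
  have h₁ : 0 ≤ v₁ := by rw [hv₁, ← vnorm_sq]; positivity
  have h₂ : 0 ≤ v₂ := by rw [hv₂, ← vnorm_sq]; positivity
  have hsum : v₁ + v₂ ≤ 4 := by
    have : v₁ + v₂ = 2 * (d ⬝ᵥ d) + 2 * (w ⬝ᵥ w) := by
      simp only [hv₁, hv₂, add_dotProduct, dotProduct_add, sub_dotProduct, dotProduct_sub]
      ring
    linarith
  have hdiff : v₁ - v₂ = 4 * (d ⬝ᵥ w) := by
    simp only [hv₁, hv₂, add_dotProduct, dotProduct_add, sub_dotProduct, dotProduct_sub,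
      dotProduct_comm w d]
    ring
  have hsmall : ∀ {v : ℝ}, 0 ≤ v → v ≤ 4 → |s / 2 * v| ≤ 1 / 4 := by
    intro v hv0 hv4
    rw [abs_mul, abs_div, abs_two, abs_of_nonneg hv0]
    nlinarith [abs_nonneg s]
  have hP := lintegral_exp_sq_gaussianVec (d + w) (θ := s / 2) (hsmall h₁ (by linarith))
  have hQ := lintegral_exp_sq_gaussianVec (d - w) (θ := -(s / 2))
    (by rw [neg_mul, abs_neg]; exact hsmall h₂ (by linarith))
  rw [← hv₁] at hP
  rw [← hv₂] at hQ
  have key := lintegral_exp_mul_le_of_sq (P := gaussianVec n)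
    (f := fun a => s / 4 * (a ⬝ᵥ (d + w)) ^ 2) (g := fun a => -(s / 4) * (a ⬝ᵥ (d - w)) ^ 2)
    (α := (s / 2 * v₁ + 4 * (s / 2 * v₁) ^ 2) / 2)
    (β := (-(s / 2) * v₂ + 4 * (-(s / 2) * v₂) ^ 2) / 2)
    (by simp only [dotProduct]; fun_prop)
    (by convert hP using 5 <;> ring) (by convert hQ using 5 <;> ring)
  refine le_trans (le_of_eq ?_) (key.trans (ENNReal.ofReal_le_ofReal (Real.exp_le_exp.2 ?_)))
  · congr with a
    congr 2
    simp only [dotProduct_add, dotProduct_sub]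
    ring
  · have hsq : v₁ ^ 2 + v₂ ^ 2 ≤ 16 := by nlinarith
    linear_combination s / 4 * hdiff + 1 / 2 * mul_le_mul_of_nonneg_left hsq (sq_nonneg s)

lemma lintegral_pi_prod {ι : Type*} [Fintype ι] {X : ι → Type*} [∀ i, MeasurableSpace (X i)]
    (P : ∀ i, Measure (X i)) [∀ i, IsProbabilityMeasure (P i)] {f : ∀ i, X i → ℝ≥0∞}
    (hf : ∀ i, Measurable (f i)) :
    ∫⁻ x, ∏ i, f i (x i) ∂(Measure.pi P) = ∏ i, ∫⁻ y, f i y ∂(P i) :=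
  (lintegral_prod_eq_prod_lintegral_of_indepFun Finset.univ (fun i (x : ∀ i, X i) => f i (x i))
    (iIndepFun_pi fun i => (hf i).aemeasurable)
    fun i => (hf i).comp (measurable_pi_apply i)).trans
  (Finset.prod_congr rfl fun i _ => (measurePreserving_eval P i).lintegral_comp (hf i))

end Gaussian

section Gradient

variable {n r q m : ℕ}

lemma dotProduct_mulVec_sum_vecMulVec (d : Fin q → Fin n → ℝ) (b : Fin q → Fin r → ℝ)
    (ω : Fin q → Fin m → Fin n → ℝ) (w : Fin n → ℝ) (z : Fin r → ℝ) :
    w ⬝ᵥ (∑ k, ∑ i, (ω k i ⬝ᵥ d k) • vecMulVec (ω k i) (b k)).mulVec z =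
      ∑ k, ∑ i, (b k ⬝ᵥ z) * ((ω k i ⬝ᵥ d k) * (ω k i ⬝ᵥ w)) := by
  simp only [sum_mulVec, dotProduct_sum, smul_mulVec, vecMulVec_mulVec, dotProduct_smul,
    smul_eq_mul, op_smul_eq_smul]
  refine Finset.sum_congr rfl fun k _ => Finset.sum_congr rfl fun i _ => ?_
  rw [dotProduct_comm w]
  ring

lemma lintegral_exp_sum_dotProduct_le {e : Fin q → Fin n → ℝ} (he : ∀ k, vnorm (e k) ≤ 1)
    {w : Fin n → ℝ} (hw : vnorm w ≤ 1) {s : Fin q → ℝ} (hs : ∀ k, |s k| ≤ 1 / 8) :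
    ∫⁻ ω, ENNReal.ofReal (Real.exp (∑ k, ∑ i, s k * ((ω k i ⬝ᵥ e k) * (ω k i ⬝ᵥ w))))
        ∂(gaussianMatrices q m n) ≤
      ENNReal.ofReal (Real.exp (m * ∑ k, (s k * (e k ⬝ᵥ w) + 8 * s k ^ 2))) := by
  let f (k : Fin q) (a : Fin n → ℝ) : ℝ≥0∞ :=
    ENNReal.ofReal (Real.exp (s k * ((a ⬝ᵥ e k) * (a ⬝ᵥ w))))
  have hf : ∀ k, Measurable (f k) := fun k => by
    simp only [f, dotProduct]
    fun_prop
  have hprod : ∀ ω : Fin q → Fin m → Fin n → ℝ,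
      ENNReal.ofReal (Real.exp (∑ k, ∑ i, s k * ((ω k i ⬝ᵥ e k) * (ω k i ⬝ᵥ w)))) =
        ∏ k, ∏ i, f k (ω k i) := by
    intro ω
    simp only [Real.exp_sum, f]
    rw [ENNReal.ofReal_prod_of_nonneg fun _ _ => by positivity]
    exact Finset.prod_congr rfl fun k _ => ENNReal.ofReal_prod_of_nonneg fun _ _ => by positivity
  simp only [hprod, gaussianMatrices]
  rw [lintegral_pi_prod (fun _ : Fin q => Measure.pi fun _ : Fin m => gaussianVec n)
    (f := fun k x => ∏ i, f k (x i))
    fun k => Finset.measurable_prod _ fun i _ => (hf k).comp (measurable_pi_apply i)]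
  rw [Finset.mul_sum, Real.exp_sum, ENNReal.ofReal_prod_of_nonneg fun _ _ => by positivity]
  refine Finset.prod_le_prod' fun k _ => ?_
  rw [lintegral_pi_prod (fun _ : Fin m => gaussianVec n) fun _ => hf k, Finset.prod_const,
    Finset.card_univ, Fintype.card_fin, Real.exp_nat_mul, ENNReal.ofReal_pow (by positivity)]
  exact pow_le_pow_left₀ zero_le (lintegral_exp_mul_dotProduct_le (he k) hw (hs k)) m

lemma measure_lt_bilinear_le {d : Fin q → Fin n → ℝ} {b : Fin q → Fin r → ℝ} {D β F S l : ℝ}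
    (hD : 0 < D) (hl : 0 ≤ l) (hd : ∀ k, vnorm (d k) ≤ D) (hb : ∀ k, vnorm (b k) ≤ β)
    (hF : frob (Matrix.of fun i k => d k i) ≤ F) (hS : spec (Matrix.of fun i k => b k i) ≤ S)
    (hlDβ : l * D * β ≤ 1 / 8) {w : Fin n → ℝ} (hw : vnorm w ≤ 1) {z : Fin r → ℝ}
    (hz : vnorm z ≤ 1) (t : ℝ) :
    gaussianMatrices q m n {ω | t <
        w ⬝ᵥ (∑ k, ∑ i, (ω k i ⬝ᵥ d k) • vecMulVec (ω k i) (b k)).mulVec z} ≤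
      ENNReal.ofReal (Real.exp (m * (l * (F * S) + 8 * l ^ 2 * D ^ 2 * S ^ 2) - l * t)) := by
  have hS0 : 0 ≤ S := (spec_nonneg _).trans hS
  have hF0 : 0 ≤ F := (Real.sqrt_nonneg _).trans hF
  set e : Fin q → Fin n → ℝ := fun k => D⁻¹ • d k with he
  set s : Fin q → ℝ := fun k => l * D * (b k ⬝ᵥ z) with hs
  set y : Fin q → ℝ := fun k => b k ⬝ᵥ z with hy
  have he1 : ∀ k, vnorm (e k) ≤ 1 := fun k => by
    rw [he, vnorm_smul, abs_of_pos (inv_pos.2 hD), inv_mul_le_iff₀ hD, mul_one]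
    exact hd k
  have hs1 : ∀ k, |s k| ≤ 1 / 8 := fun k => by
    refine le_trans ?_ hlDβ
    rw [hs, abs_mul, abs_of_nonneg (by positivity)]
    refine mul_le_mul_of_nonneg_left ?_ (by positivity)
    refine (abs_dotProduct_le _ _).trans ?_
    exact (mul_le_of_le_one_right (vnorm_nonneg _) hz).trans (hb k)
  have hyS : vnorm y ≤ S := by
    have h : y = vecMul z (Matrix.of fun i k => b k i) := by
      ext k
      simp only [hy, vecMul, dotProduct, Matrix.of_apply]
      exact Finset.sum_congr rfl fun _ _ => mul_comm _ _
    rw [h]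
    refine (vnorm_vecMul_le_spec _ _).trans ?_
    exact (mul_le_of_le_one_right (spec_nonneg _) hz).trans hS
  have hysq : ∑ k, y k ^ 2 ≤ S ^ 2 := by
    have : ∑ k, y k ^ 2 = vnorm y ^ 2 := by
      rw [vnorm_sq]
      simp only [dotProduct, sq]
    rw [this]
    exact pow_le_pow_left₀ (vnorm_nonneg _) hyS 2
  have hmean : ∑ k, y k * (d k ⬝ᵥ w) ≤ F * S := by
    have h : ∑ k, y k * (d k ⬝ᵥ w) = w ⬝ᵥ (Matrix.of fun i k => d k i).mulVec y := by
      simp only [dotProduct, mulVec, Matrix.of_apply, Finset.mul_sum]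
      rw [Finset.sum_comm]
      exact Finset.sum_congr rfl fun _ _ => Finset.sum_congr rfl fun _ _ => by ring
    rw [h]
    refine (dotProduct_le_vnorm _ _).trans ?_
    refine (mul_le_of_le_one_left (vnorm_nonneg _) hw).trans ?_
    exact (vnorm_mulVec_le_frob _ _).trans (mul_le_mul hF hyS (vnorm_nonneg _) hF0)
  have hexp : ∀ ω : Fin q → Fin m → Fin n → ℝ,
      l * (w ⬝ᵥ (∑ k, ∑ i, (ω k i ⬝ᵥ d k) • vecMulVec (ω k i) (b k)).mulVec z) =
        ∑ k, ∑ i, s k * ((ω k i ⬝ᵥ e k) * (ω k i ⬝ᵥ w)) := by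
    intro ω
    rw [dotProduct_mulVec_sum_vecMulVec, Finset.mul_sum]
    refine Finset.sum_congr rfl fun k _ => ?_
    rw [Finset.mul_sum]
    refine Finset.sum_congr rfl fun i _ => ?_
    simp only [hs, he, dotProduct_smul, smul_eq_mul]
    field_simp
  have hsum : ∑ k, (s k * (e k ⬝ᵥ w) + 8 * s k ^ 2) ≤
      l * (F * S) + 8 * l ^ 2 * D ^ 2 * S ^ 2 := by
    have h : ∑ k, (s k * (e k ⬝ᵥ w) + 8 * s k ^ 2) =
        l * ∑ k, y k * (d k ⬝ᵥ w) + 8 * l ^ 2 * D ^ 2 * ∑ k, y k ^ 2 := by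
      rw [Finset.sum_add_distrib, Finset.mul_sum, Finset.mul_sum]
      congr 1
      · refine Finset.sum_congr rfl fun k _ => ?_
        simp only [hs, he, hy, smul_dotProduct, smul_eq_mul]
        field_simp
      · refine Finset.sum_congr rfl fun k _ => ?_
        simp only [hs, hy]
        ring
    rw [h]
    gcongr
  calc gaussianMatrices q m n {ω | t <
        w ⬝ᵥ (∑ k, ∑ i, (ω k i ⬝ᵥ d k) • vecMulVec (ω k i) (b k)).mulVec z}
      ≤ gaussianMatrices q m n {ω | ENNReal.ofReal (Real.exp (l * t)) ≤ ENNReal.ofReal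
          (Real.exp (∑ k, ∑ i, s k * ((ω k i ⬝ᵥ e k) * (ω k i ⬝ᵥ w))))} := by
        refine measure_mono fun ω hω => ENNReal.ofReal_le_ofReal (Real.exp_le_exp.2 ?_)
        rw [← hexp]
        exact mul_le_mul_of_nonneg_left (le_of_lt hω) hl
    _ ≤ (∫⁻ ω, ENNReal.ofReal (Real.exp (∑ k, ∑ i, s k * ((ω k i ⬝ᵥ e k) * (ω k i ⬝ᵥ w))))
          ∂(gaussianMatrices q m n)) / ENNReal.ofReal (Real.exp (l * t)) := by
        refine meas_ge_le_lintegral_div ?_ ?_ ENNReal.ofReal_ne_top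
        · refine Measurable.aemeasurable ?_
          simp only [dotProduct]
          fun_prop
        · exact (ENNReal.ofReal_pos.2 (Real.exp_pos _)).ne'
    _ ≤ ENNReal.ofReal (Real.exp (m * ∑ k, (s k * (e k ⬝ᵥ w) + 8 * s k ^ 2))) /
          ENNReal.ofReal (Real.exp (l * t)) :=
        ENNReal.div_le_div_right (lintegral_exp_sum_dotProduct_le he1 hw hs1) _
    _ = ENNReal.ofReal (Real.exp (m * ∑ k, (s k * (e k ⬝ᵥ w) + 8 * s k ^ 2) - l * t)) := by
        rw [← ENNReal.ofReal_div_of_pos (Real.exp_pos _), ← Real.exp_sub]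
    _ ≤ _ := by
        refine ENNReal.ofReal_le_ofReal (Real.exp_le_exp.2 ?_)
        gcongr

/-- Union bound over nets of the unit balls, for any random matrix `M`. -/
lemma ofReal_le_measure_spec_le {Ω : Type*} [MeasurableSpace Ω] {P : Measure Ω}
    [IsProbabilityMeasure P] (M : Ω → Matrix (Fin n) (Fin r) ℝ) {t x : ℝ} (ht : 0 ≤ t)
    (h : ∀ w z, vnorm w ≤ 1 → vnorm z ≤ 1 →
      P {ω | t < w ⬝ᵥ (M ω).mulVec z} ≤ ENNReal.ofReal (Real.exp (-x))) :
    ENNReal.ofReal (1 - Real.exp (3 * ((n : ℝ) + r) - x)) ≤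
      P {ω | spec (M ω) ≤ 4 / 3 * t} := by
  obtain ⟨N, hNcard, hN, hcov⟩ := exists_net_unitBall n
  obtain ⟨N', hN'card, hN', hcov'⟩ := exists_net_unitBall r
  have hbad : P {ω | spec (M ω) ≤ 4 / 3 * t}ᶜ ≤
      ENNReal.ofReal (Real.exp (3 * ((n : ℝ) + r) - x)) := by
    have hsub : {ω | spec (M ω) ≤ 4 / 3 * t}ᶜ ⊆
        ⋃ p ∈ N ×ˢ N', {ω | t < p.1 ⬝ᵥ (M ω).mulVec p.2} := by
      intro ω hω
      by_contra hcon
      simp only [Set.mem_iUnion, Finset.mem_product, Set.mem_ofPred_eq, not_exists, not_lt,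
        and_imp, Prod.forall] at hcon
      exact hω (spec_le_of_net (M ω) ht hN hcov hcov' fun w hw z hz => hcon w z hw hz)
    have hexp : (17 : ℝ) ≤ Real.exp 3 := by
      have h1 := Real.exp_one_gt_d9.le
      have h2 : Real.exp 3 = Real.exp 1 ^ 3 := by rw [← Real.exp_nat_mul]; norm_num
      rw [h2]
      calc (17 : ℝ) ≤ 2.7182818283 ^ 3 := by norm_num
        _ ≤ _ := by gcongr
    calc P {ω | spec (M ω) ≤ 4 / 3 * t}ᶜ
        ≤ ∑ p ∈ N ×ˢ N', P {ω | t < p.1 ⬝ᵥ (M ω).mulVec p.2} :=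
          (measure_mono hsub).trans (measure_biUnion_finset_le _ _)
      _ ≤ ∑ p ∈ N ×ˢ N', ENNReal.ofReal (Real.exp (-x)) := by
          refine Finset.sum_le_sum fun p hp => ?_
          obtain ⟨h1, h2⟩ := Finset.mem_product.1 hp
          exact h _ _ (hN _ h1) (hN' _ h2)
      _ = ENNReal.ofReal ((N.card * N'.card : ℕ) * Real.exp (-x)) := by
          rw [Finset.sum_const, Finset.card_product, nsmul_eq_mul,
            ENNReal.ofReal_mul (Nat.cast_nonneg _), ENNReal.ofReal_natCast]
      _ ≤ ENNReal.ofReal (Real.exp (3 * ((n : ℝ) + r) - x)) := by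
          refine ENNReal.ofReal_le_ofReal ?_
          rw [sub_eq_add_neg, Real.exp_add]
          refine mul_le_mul_of_nonneg_right ?_ (Real.exp_pos _).le
          calc ((N.card * N'.card : ℕ) : ℝ) ≤ ((17 ^ n * 17 ^ r : ℕ) : ℝ) :=
                Nat.cast_le.2 (Nat.mul_le_mul hNcard hN'card)
            _ = 17 ^ (n + r) := by push_cast; rw [pow_add]
            _ ≤ Real.exp 3 ^ (n + r) := by gcongr
            _ = Real.exp (3 * ((n : ℝ) + r)) := by
                rw [← Real.exp_nat_mul]
                push_cast
                ring_nf
  rw [ENNReal.ofReal_sub _ (Real.exp_pos _).le, ENNReal.ofReal_one, tsub_le_iff_right]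
  calc (1 : ℝ≥0∞) = P Set.univ := measure_univ.symm
    _ ≤ P {ω | spec (M ω) ≤ 4 / 3 * t} + P {ω | spec (M ω) ≤ 4 / 3 * t}ᶜ := by
        rw [← Set.union_compl_self {ω | spec (M ω) ≤ 4 / 3 * t}]
        exact measure_union_le _ _
    _ ≤ _ := by gcongr

end Gradient

/-- **Lemma 3.5, part 1** (bound on the gradient term). -/
theorem lemma35_part1 :
    ∃ c C : ℝ, 0 < c ∧ 0 < C ∧
    ∀ (n r q m : ℕ), r ≤ q →
    ∀ (δ σp μ ε₁ : ℝ), 0 < δ → 0 < σp → 1 ≤ μ → 0 < ε₁ → ε₁ < 1 →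
    ∀ (U : Matrix (Fin n) (Fin r) ℝ) (bhat : Fin q → Fin r → ℝ)
      (xstar : Fin q → Fin n → ℝ),
      (∀ k, vnorm (bhat k) ≤ 1.1 * μ * σp * Real.sqrt ((r : ℝ) / q)) →
      (∀ k, vnorm (U.mulVec (bhat k) - xstar k) ≤ 1.4 * δ * μ * σp * Real.sqrt ((r : ℝ) / q)) →
      frob (Matrix.of fun (i : Fin n) (k : Fin q) => U.mulVec (bhat k) i - xstar k i) ≤
        1.1 * δ * σp →
      spec (Matrix.of fun (i : Fin r) (k : Fin q) => bhat k i) ≤ 1.1 * σp →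
      ENNReal.ofReal (1 - Real.exp (C * ((n : ℝ) + r) - c * m * q * ε₁ ^ 2 / (r * μ ^ 2))) ≤
        gaussianMatrices q m n {ω | spec (∑ k, ∑ i,
            (ω k i ⬝ᵥ (U.mulVec (bhat k) - xstar k)) • vecMulVec (ω k i) (bhat k)) ≤
          1.5 * (1.1 + ε₁) * m * δ * σp ^ 2} := by
  refine ⟨1 / 100, 3, by norm_num, by norm_num, ?_⟩
  intro n r q m hrq δ σp μ ε₁ hδ hσ hμ hε hε1 U bhat xstar hb hd hF hS
  rcases Nat.eq_zero_or_pos r with rfl | hr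
  · have : (1 : ℝ) ≤ Real.exp (3 * ((n : ℝ) + (0 : ℕ)) -
        1 / 100 * m * q * ε₁ ^ 2 / ((0 : ℕ) * μ ^ 2)) := by
      refine Real.one_le_exp ?_
      simp
    rw [ENNReal.ofReal_of_nonpos (by linarith)]
    exact zero_le
  have hrR : (0 : ℝ) < r := Nat.cast_pos.2 hr
  have hqR : (0 : ℝ) < q := Nat.cast_pos.2 (hr.trans_le hrq)
  have hμ0 : 0 < μ := by linarith
  have hρ : 0 < Real.sqrt ((r : ℝ) / q) := Real.sqrt_pos.2 (by positivity)
  have hρ2 : Real.sqrt ((r : ℝ) / q) ^ 2 = r / q := Real.sq_sqrt (by positivity)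
  set ρ := Real.sqrt ((r : ℝ) / q)
  have hexponent : 1 / 100 * m * q * ε₁ ^ 2 / (r * μ ^ 2) =
      1 / 100 * m * ε₁ ^ 2 / (ρ ^ 2 * μ ^ 2) := by
    rw [hρ2]
    field_simp
  set l := ε₁ / (40 * δ * σp ^ 2 * μ ^ 2 * ρ ^ 2) with hl
  have hl0 : 0 ≤ l := by positivity
  have hlDβ : l * (1.4 * δ * μ * σp * ρ) * (1.1 * μ * σp * ρ) ≤ 1 / 8 := by
    have : l * (1.4 * δ * μ * σp * ρ) * (1.1 * μ * σp * ρ) = 1.54 / 40 * ε₁ := by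
      rw [hl]
      field_simp
      norm_num
    rw [this]
    linarith
  have hmain := ofReal_le_measure_spec_le (P := gaussianMatrices q m n)
    (fun ω => ∑ k, ∑ i, (ω k i ⬝ᵥ (U.mulVec (bhat k) - xstar k)) • vecMulVec (ω k i) (bhat k))
    (t := (1.21 + ε₁) * m * δ * σp ^ 2) (x := 1 / 100 * m * ε₁ ^ 2 / (ρ ^ 2 * μ ^ 2))
    (by positivity) fun w z hw hz => by
      refine (measure_lt_bilinear_le (by positivity) hl0 hd hb hF hS hlDβ hw hz _).trans
        (ENNReal.ofReal_le_ofReal (Real.exp_le_exp.2 ?_))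
      have e : m * (l * (1.1 * δ * σp * (1.1 * σp)) +
          8 * l ^ 2 * (1.4 * δ * μ * σp * ρ) ^ 2 * (1.1 * σp) ^ 2) -
          l * ((1.21 + ε₁) * m * δ * σp ^ 2) =
          -((1 / 40 - 18.9728 / 1600) * (m * ε₁ ^ 2 / (ρ ^ 2 * μ ^ 2))) := by
        rw [hl]
        field_simp
        ring
      have h0 : 0 ≤ m * ε₁ ^ 2 / (ρ ^ 2 * μ ^ 2) := by positivity
      rw [e, mul_assoc (1 / 100 : ℝ), mul_div_assoc (1 / 100 : ℝ)]
      linarith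
  rw [hexponent]
  refine hmain.trans (measure_mono (Set.ofPred_subset_ofPred.2 fun ω hω => hω.trans ?_))
  have h0 : 0 ≤ m * δ * σp ^ 2 := by positivity
  nlinarith [mul_nonneg hε.le h0]
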